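/- Let n be a positive integer, let M be a real symmetric positive definite n×n matrix with largest eigenvalue λ_max, let m be a positive integer, and let x₁, x₂ ∈ ℝ^n each have every coordinate in [0,1]. Then |(x₁ᵀ M x₁)^m − (x₂ᵀ M x₂)^m| ≤ (2/√n) · m · (n λ_max)^m · ‖x₁ − x₂‖. -/

import Mathlib

open scoped InnerProductSpace

/-- A symmetric operator with an orthonormal eigenbasis and all eigenvalues in `[0, c]` has norm at
most `c`. -/
theorem OrthonormalBasis.norm_apply_le_of_eigenvalue_le {ι E : Type*} [Fintype ι]
    [NormedAddCommGroup E] [InnerProductSpace ℝ E] (b : OrthonormalBasis ι ℝ E)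
    {T : E →ₗ[ℝ] E} (hT : T.IsSymmetric) {μ : ι → ℝ} (hb : ∀ i, T (b i) = μ i • b i)
    (hμ : ∀ i, 0 ≤ μ i) {c : ℝ} (hc : 0 ≤ c) (hμc : ∀ i, μ i ≤ c) (v : E) :
    ‖T v‖ ≤ c * ‖v‖ := by
  refine le_of_sq_le_sq ?_ (by positivity)
  rw [mul_pow, ← b.sum_sq_norm_inner_right (T v), ← b.sum_sq_norm_inner_right v, Finset.mul_sum]
  refine Finset.sum_le_sum fun i _ => ?_
  rw [← hT, hb, real_inner_smul_left, norm_mul, mul_pow, Real.norm_of_nonneg (hμ i)]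
  gcongr
  · exact hμ i
  · exact hμc i

theorem Matrix.IsHermitian.eigenvalues_le_of_forall_mulVec {ι : Type*} [Fintype ι]
    [DecidableEq ι] {M : Matrix ι ι ℝ} (hM : M.IsHermitian) {c : ℝ}
    (hub : ∀ (μ : ℝ) (v : ι → ℝ), v ≠ 0 → M.mulVec v = μ • v → μ ≤ c) (i : ι) :
    hM.eigenvalues i ≤ c := by
  refine hub _ _ (fun h => ?_) (hM.mulVec_eigenvectorBasis i)
  exact hM.eigenvectorBasis.orthonormal.ne_zero i (by ext j; exact congrFun h j)

/-- The Euclidean operator norm of a positive definite matrix is at most any nonnegative upper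
bound of its eigenvalues. -/
theorem Matrix.PosDef.norm_toEuclideanLin_apply_le {ι : Type*} [Fintype ι] [DecidableEq ι]
    {M : Matrix ι ι ℝ} (hM : M.PosDef) {c : ℝ} (hc : 0 ≤ c)
    (hub : ∀ (μ : ℝ) (v : ι → ℝ), v ≠ 0 → M.mulVec v = μ • v → μ ≤ c)
    (v : EuclideanSpace ℝ ι) : ‖M.toEuclideanLin v‖ ≤ c * ‖v‖ := by
  refine hM.isHermitian.eigenvectorBasis.norm_apply_le_of_eigenvalue_le
    (Matrix.isSymmetric_toEuclideanLin_iff.2 hM.isHermitian) (μ := hM.isHermitian.eigenvalues)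
    (fun i => ?_) (fun i => (hM.eigenvalues_pos i).le) hc
    (hM.isHermitian.eigenvalues_le_of_forall_mulVec hub) v
  ext j
  exact congrFun (hM.isHermitian.mulVec_eigenvectorBasis i) j

theorem Matrix.inner_toEuclideanLin_self {ι : Type*} [Fintype ι] [DecidableEq ι]
    (M : Matrix ι ι ℝ) (x : EuclideanSpace ℝ ι) :
    ⟪x, M.toEuclideanLin x⟫_ℝ = ∑ i, ∑ j, x i * M i j * x j := by
  simp only [PiLp.inner_apply, Matrix.toLpLin_apply, Matrix.mulVec, dotProduct]
  refine Finset.sum_congr rfl fun i _ => ?_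
  simp only [inner, star_trivial, RCLike.re_to_real, Finset.sum_mul]
  exact Finset.sum_congr rfl fun j _ => by ring

theorem EuclideanSpace.norm_le_sqrt_card_of_mem_Icc {ι : Type*} [Fintype ι]
    {x : EuclideanSpace ℝ ι} (hx : ∀ i, x i ∈ Set.Icc (0 : ℝ) 1) :
    ‖x‖ ≤ √(Fintype.card ι) := by
  rw [EuclideanSpace.norm_eq]
  refine Real.sqrt_le_sqrt ?_
  calc ∑ i, ‖x i‖ ^ 2 ≤ ∑ _i : ι, (1 : ℝ) := Finset.sum_le_sum fun i _ => by
        rw [Real.norm_of_nonneg (hx i).1]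
        exact pow_le_one₀ (hx i).1 (hx i).2
    _ = Fintype.card ι := by simp

theorem LinearMap.IsSymmetric.inner_self_sub_inner_self {E : Type*} [NormedAddCommGroup E]
    [InnerProductSpace ℝ E] {T : E →ₗ[ℝ] E} (hT : T.IsSymmetric) (x y : E) :
    ⟪x, T x⟫_ℝ - ⟪y, T y⟫_ℝ = ⟪x - y, T (x + y)⟫_ℝ := by
  have h : ⟪x, T y⟫_ℝ = ⟪y, T x⟫_ℝ := by rw [← hT, real_inner_comm]
  simp only [map_add, inner_add_right, inner_sub_left, h]
  ring


/-- Lemma 4 of the paper: for a real symmetric positive definite `n × n` matrix `M`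
with largest eigenvalue `lammax`, a positive integer `m`, and `x₁, x₂ ∈ [0,1]^n`,
`|(x₁ᵀ M x₁)^m − (x₂ᵀ M x₂)^m| ≤ (2/√n) m (n lammax)^m ‖x₁ − x₂‖`. -/
theorem quadform_pow_diff_bound (n : ℕ) (hn : 0 < n)
    (M : Matrix (Fin n) (Fin n) ℝ) (hM : M.PosDef) (lammax : ℝ)
    (hub : ∀ (μ : ℝ) (v : Fin n → ℝ), v ≠ 0 → M.mulVec v = μ • v → μ ≤ lammax)
    (hmem : ∃ v : Fin n → ℝ, v ≠ 0 ∧ M.mulVec v = lammax • v)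
    (m : ℕ) (hm : 0 < m)
    (x₁ x₂ : EuclideanSpace ℝ (Fin n))
    (hx₁ : ∀ i, x₁ i ∈ Set.Icc (0 : ℝ) 1) (hx₂ : ∀ i, x₂ i ∈ Set.Icc (0 : ℝ) 1) :
    |(∑ i, ∑ j, x₁ i * M i j * x₁ j) ^ m - (∑ i, ∑ j, x₂ i * M i j * x₂ j) ^ m| ≤
      2 / Real.sqrt n * m * ((n : ℝ) * lammax) ^ m * ‖x₁ - x₂‖ := by
  have hlam : 0 ≤ lammax := (hM.eigenvalues_pos ⟨0, hn⟩).le.trans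
    (hM.isHermitian.eigenvalues_le_of_forall_mulVec hub _)
  have hT := Matrix.isSymmetric_toEuclideanLin_iff.2 hM.isHermitian
  have hinner (u v : EuclideanSpace ℝ (Fin n)) :
      |⟪u, M.toEuclideanLin v⟫_ℝ| ≤ ‖u‖ * (lammax * ‖v‖) :=
    (abs_real_inner_le_norm _ _).trans <| by
      gcongr
      exact hM.norm_toEuclideanLin_apply_le hlam hub v
  have hs : √(n : ℝ) * √n = n := Real.mul_self_sqrt n.cast_nonneg
  have hs0 : √(n : ℝ) ≠ 0 := by positivity
  have hnorm {x : EuclideanSpace ℝ (Fin n)} (hx : ∀ i, x i ∈ Set.Icc (0 : ℝ) 1) : ‖x‖ ≤ √n := by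
    simpa using EuclideanSpace.norm_le_sqrt_card_of_mem_Icc hx
  have hquad {x : EuclideanSpace ℝ (Fin n)} (hx : ∀ i, x i ∈ Set.Icc (0 : ℝ) 1) :
      |⟪x, M.toEuclideanLin x⟫_ℝ| ≤ n * lammax :=
    calc _ ≤ ‖x‖ * (lammax * ‖x‖) := hinner x x
      _ ≤ √n * (lammax * √n) := by gcongr <;> exact hnorm hx
      _ = n * lammax := by rw [mul_left_comm, hs, mul_comm]
  have hdiff : |⟪x₁, M.toEuclideanLin x₁⟫_ℝ - ⟪x₂, M.toEuclideanLin x₂⟫_ℝ| ≤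
      2 * lammax * √n * ‖x₁ - x₂‖ := by
    rw [hT.inner_self_sub_inner_self]
    calc _ ≤ ‖x₁ - x₂‖ * (lammax * ‖x₁ + x₂‖) := hinner _ _
      _ ≤ ‖x₁ - x₂‖ * (lammax * (√n + √n)) := by
        gcongr
        exact (norm_add_le _ _).trans (add_le_add (hnorm hx₁) (hnorm hx₂))
      _ = _ := by ring
  simp only [← Matrix.inner_toEuclideanLin_self]
  calc _ ≤ _ := abs_pow_sub_pow_le _ _ _
    _ ≤ 2 * lammax * √n * ‖x₁ - x₂‖ * m * (n * lammax) ^ (m - 1) := by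
      gcongr
      exact max_le (hquad hx₁) (hquad hx₂)
    _ = _ := by
      obtain ⟨k, rfl⟩ := Nat.exists_eq_succ_of_ne_zero hm.ne'
      have hdiv : (n : ℝ) / √n = √n := Real.div_sqrt
      rw [Nat.succ_eq_add_one, Nat.add_sub_cancel, pow_succ]
      nth_rewrite 1 [← hdiv]
      ring
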